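/- Let n ≥ 2 and let F : ℝ^{n+1} → ℝ^{n+1} be a C² diffeomorphism (a bijection which is twice continuously differentiable with twice continuously differentiable inverse) with everywhere invertible Jacobian, and suppose that ∂y_{n+1}/∂x_{n+1} ≥ 0 everywhere and that for every C² function ψ : ℝ^{n+1} → ℝ, □(ψ∘F) = 0 on ℝ^{n+1} if and only if □ψ = 0 on ℝ^{n+1}. Then F is C^∞ (indeed affine: F(x) = a·(A x) + b for some a > 0, orthochronous Lorentz matrix A, and b ∈ ℝ^{n+1}). -/

import Mathlib

open scoped BigOperators
open Matrix

noncomputable section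

/-- Sign vector of the Minkowski metric: `+1` for the first `n` coordinates, `-1` for the last. -/
def eps (n : ℕ) (i : Fin (n + 1)) : ℝ := if i = Fin.last n then -1 else 1

/-- The Minkowski bilinear form `η(u,v) = Σ_{i<n} u_i v_i − u_n v_n` on `ℝ^{n+1}`. -/
def eta (n : ℕ) (u v : Fin (n + 1) → ℝ) : ℝ := ∑ i, eps n i * u i * v i

/-- Partial derivative in the `i`-th coordinate direction. -/
def pd (n : ℕ) (f : (Fin (n + 1) → ℝ) → ℝ) (i : Fin (n + 1)) (x : Fin (n + 1) → ℝ) : ℝ :=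
  fderiv ℝ f x (Pi.single i 1)

/-- The wave operator `□φ = Σ_{i=1}^n ∂²φ/∂x_i² − ∂²φ/∂x_{n+1}²`. -/
def waveOp (n : ℕ) (f : (Fin (n + 1) → ℝ) → ℝ) (x : Fin (n + 1) → ℝ) : ℝ :=
  ∑ i, eps n i * pd n (pd n f i) i x

/-- The causal order on Minkowski space: `x ≤ y` iff `y − x` is causal and future-pointing. -/
def causalLe (n : ℕ) (x y : Fin (n + 1) → ℝ) : Prop :=
  eta n (y - x) (y - x) ≤ 0 ∧ x (Fin.last n) ≤ y (Fin.last n)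

/-- A causal automorphism: a bijection preserving the causal order in both directions. -/
def IsCausalAuto (n : ℕ) (F : (Fin (n + 1) → ℝ) → (Fin (n + 1) → ℝ)) : Prop :=
  Function.Bijective F ∧ ∀ x y, causalLe n x y ↔ causalLe n (F x) (F y)

/-- The matrix `η = diag(1, …, 1, −1)`. -/
def etaM (n : ℕ) : Matrix (Fin (n + 1)) (Fin (n + 1)) ℝ := Matrix.diagonal (eps n)

/-- A Lorentz matrix: `Aᵀ η A = η`. -/
def IsLorentz (n : ℕ) (A : Matrix (Fin (n + 1)) (Fin (n + 1)) ℝ) : Prop :=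
  Aᵀ * etaM n * A = etaM n

/-- The `i`-th row of the Jacobian of `F` at `x`. -/
def jacRow (n : ℕ) (F : (Fin (n + 1) → ℝ) → (Fin (n + 1) → ℝ)) (i : Fin (n + 1))
    (x : Fin (n + 1) → ℝ) : Fin (n + 1) → ℝ :=
  fun j => pd n (fun z => F z i) j x

section PartialDerivatives

variable {n : ℕ} {f g : (Fin (n + 1) → ℝ) → ℝ} {i : Fin (n + 1)} {x : Fin (n + 1) → ℝ}

lemma eps_mul_self (n : ℕ) (i : Fin (n + 1)) : eps n i * eps n i = 1 := by
  unfold eps; split_ifs <;> norm_num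

lemma eps_ne_zero (n : ℕ) (i : Fin (n + 1)) : eps n i ≠ 0 := by
  unfold eps; split_ifs <;> norm_num

lemma contDiff_pd (hf : ContDiff ℝ 2 f) (i : Fin (n + 1)) : ContDiff ℝ 1 (pd n f i) :=
  (hf.fderiv_right (m := 1) (by norm_num)).clm_apply contDiff_const

lemma differentiable_pd (hf : ContDiff ℝ 2 f) (i : Fin (n + 1)) : Differentiable ℝ (pd n f i) :=
  (contDiff_pd hf i).differentiable (by norm_num)

lemma pd_add (hf : DifferentiableAt ℝ f x) (hg : DifferentiableAt ℝ g x) :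
    pd n (fun z => f z + g z) i x = pd n f i x + pd n g i x := by
  simp [pd, fderiv_fun_add hf hg]

lemma pd_mul (hf : DifferentiableAt ℝ f x) (hg : DifferentiableAt ℝ g x) :
    pd n (fun z => f z * g z) i x = f x * pd n g i x + g x * pd n f i x := by
  simp [pd, fderiv_fun_mul hf hg]

lemma pd_const_mul (c : ℝ) (hf : DifferentiableAt ℝ f x) :
    pd n (fun z => c * f z) i x = c * pd n f i x := by
  simp [pd, fderiv_const_mul hf c]

lemma pd_sum {ι : Type*} (s : Finset ι) {φ : ι → (Fin (n + 1) → ℝ) → ℝ}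
    (hφ : ∀ k ∈ s, DifferentiableAt ℝ (φ k) x) :
    pd n (fun z => ∑ k ∈ s, φ k z) i x = ∑ k ∈ s, pd n (φ k) i x := by
  simp [pd, fderiv_fun_sum hφ]

lemma pd_coord (k i : Fin (n + 1)) (x : Fin (n + 1) → ℝ) :
    pd n (fun z => z k) i x = if k = i then 1 else 0 := by
  have h : fderiv ℝ (fun z : Fin (n + 1) → ℝ => z k) x = ContinuousLinearMap.proj k :=
    (ContinuousLinearMap.proj (R := ℝ) (φ := fun _ : Fin (n + 1) => ℝ) k).fderiv
  simp [pd, h, Pi.single_apply]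

lemma pd_comm (hf : ContDiff ℝ 2 f) (i j : Fin (n + 1)) (x : Fin (n + 1) → ℝ) :
    pd n (pd n f i) j x = pd n (pd n f j) i x := by
  have hd : DifferentiableAt ℝ (fderiv ℝ f) x :=
    (hf.fderiv_right (m := 1) (by norm_num)).differentiable (by norm_num) x
  have key : ∀ i j, pd n (pd n f i) j x =
      fderiv ℝ (fderiv ℝ f) x (Pi.single j 1) (Pi.single i 1) := fun i j => by
    unfold pd
    rw [fderiv_clm_apply hd (differentiableAt_const _)]
    simp
  rw [key, key]
  exact (hf.contDiffAt.isSymmSndFDerivAt (by simp)).eq _ _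

lemma fderiv_eq_zero_of_pd_eq_zero (h : ∀ i, pd n f i x = 0) : fderiv ℝ f x = 0 := by
  refine ContinuousLinearMap.coe_injective ((Pi.basisFun ℝ _).ext fun i => ?_)
  simpa [pd] using h i

lemma eq_of_pd_eq_zero (hf : Differentiable ℝ f) (h : ∀ i x, pd n f i x = 0)
    (x y : Fin (n + 1) → ℝ) : f x = f y :=
  is_const_of_fderiv_eq_zero hf (fun z => fderiv_eq_zero_of_pd_eq_zero fun i => h i z) x y

/-- A `C²` function with vanishing second partial derivatives is affine. -/
lemma eq_sum_pd_mul_add (hf : ContDiff ℝ 2 f) (h : ∀ i j x, pd n (pd n f i) j x = 0)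
    (x : Fin (n + 1) → ℝ) : f x = ∑ i, pd n f i 0 * x i + f 0 := by
  have hd : Differentiable ℝ f := hf.differentiable (by norm_num)
  have hl : ∀ i, Differentiable ℝ fun z : Fin (n + 1) → ℝ => -pd n f i 0 * z i := fun i => by
    fun_prop
  have hs : Differentiable ℝ fun z : Fin (n + 1) → ℝ => ∑ i, -pd n f i 0 * z i := by
    fun_prop
  have key := eq_of_pd_eq_zero (hd.add hs) (fun i z => by
    refine (pd_add (hd z) (hs z)).trans ?_
    rw [pd_sum _ fun k _ => hl k z]
    simp_rw [pd_const_mul _ (differentiableAt_apply _ _), pd_coord]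
    have := eq_of_pd_eq_zero (differentiable_pd hf i) (h i) z 0
    simp [this]) x 0
  simp only [Pi.add_apply, Pi.zero_apply, mul_zero, Finset.sum_const_zero, neg_mul,
    Finset.sum_neg_distrib] at key
  linarith

lemma waveOp_add (hf : ContDiff ℝ 2 f) (hg : ContDiff ℝ 2 g) (x : Fin (n + 1) → ℝ) :
    waveOp n (fun z => f z + g z) x = waveOp n f x + waveOp n g x := by
  unfold waveOp
  rw [← Finset.sum_add_distrib]
  refine Finset.sum_congr rfl fun i _ => ?_
  have h : pd n (fun z => f z + g z) i = fun z => pd n f i z + pd n g i z := funext fun z =>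
    pd_add (hf.differentiable (by norm_num) z) (hg.differentiable (by norm_num) z)
  rw [h, pd_add (differentiable_pd hf i x) (differentiable_pd hg i x), mul_add]

lemma waveOp_mul (hf : ContDiff ℝ 2 f) (hg : ContDiff ℝ 2 g) (x : Fin (n + 1) → ℝ) :
    waveOp n (fun z => f z * g z) x = f x * waveOp n g x + g x * waveOp n f x
      + 2 * ∑ i, eps n i * pd n f i x * pd n g i x := by
  unfold waveOp
  simp only [Finset.mul_sum, ← Finset.sum_add_distrib]
  refine Finset.sum_congr rfl fun i _ => ?_
  have hf' : Differentiable ℝ f := hf.differentiable (by norm_num)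
  have hg' : Differentiable ℝ g := hg.differentiable (by norm_num)
  have h : pd n (fun z => f z * g z) i = fun z => f z * pd n g i z + g z * pd n f i z :=
    funext fun z => pd_mul (hf' z) (hg' z)
  have hfi := differentiable_pd hf i
  have hgi := differentiable_pd hg i
  rw [h, pd_add ((hf' x).fun_mul (hgi x)) ((hg' x).fun_mul (hfi x)), pd_mul (hf' x) (hgi x),
    pd_mul (hg' x) (hfi x)]
  ring

lemma waveOp_coord (k : Fin (n + 1)) (x : Fin (n + 1) → ℝ) :
    waveOp n (fun z => z k) x = 0 := by
  have h : ∀ i, pd n (fun z => z k) i = fun _ => if k = i then 1 else 0 := fun i =>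
    funext fun z => pd_coord k i z
  simp [waveOp, h, pd]

lemma waveOp_coord_mul_coord (k l : Fin (n + 1)) (x : Fin (n + 1) → ℝ) :
    waveOp n (fun z => z k * z l) x = if k = l then 2 * eps n k else 0 := by
  rw [waveOp_mul (contDiff_apply ℝ ℝ k) (contDiff_apply ℝ ℝ l)]
  simp only [waveOp_coord, pd_coord]
  by_cases h : k = l
  · simp [h]
  · simp [h]

end PartialDerivatives

/-- Two `η`-orthogonal vectors in Minkowski space cannot both be timelike. -/
lemma not_both_timelike {n : ℕ} {u v : Fin (n + 1) → ℝ} (huv : eta n u v = 0)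
    (hu : eta n u u < 0) (hv : eta n v v < 0) : False := by
  have key : ∀ a b : Fin (n + 1) → ℝ, eta n a b =
      ∑ i : Fin n, a i.castSucc * b i.castSucc - a (Fin.last n) * b (Fin.last n) := fun a b => by
    simp [eta, Fin.sum_univ_castSucc, eps, (Fin.castSucc_lt_last _).ne, sub_eq_add_neg]
  rw [key] at huv hu hv
  have cs := Finset.sum_mul_sq_le_sq_mul_sq Finset.univ
    (fun i : Fin n => u i.castSucc) (fun i => v i.castSucc)
  simp only [← pow_two] at hu hv
  have hu0 : 0 ≤ ∑ i : Fin n, u i.castSucc ^ 2 := Finset.sum_nonneg fun _ _ => sq_nonneg _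
  have hv0 : 0 ≤ ∑ i : Fin n, v i.castSucc ^ 2 := Finset.sum_nonneg fun _ _ => sq_nonneg _
  rw [sub_eq_zero.mp huv, mul_pow] at cs
  exact absurd cs (not_le.mpr (mul_lt_mul'' (by linarith) (by linarith) hu0 hv0))

/-- A conformal Lorentz relation for the rows of a matrix transfers to its columns. -/
lemma transpose_mul_etaM_mul {n : ℕ} {J : Matrix (Fin (n + 1)) (Fin (n + 1)) ℝ} {c : ℝ}
    (hc : c ≠ 0) (h : J * etaM n * Jᵀ = c • etaM n) : Jᵀ * etaM n * J = c • etaM n := by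
  have hη : etaM n * etaM n = 1 := by
    simp [etaM, Matrix.diagonal_mul_diagonal, eps_mul_self]
  have h1 : J * (c⁻¹ • (etaM n * Jᵀ * etaM n)) = 1 := by
    rw [Matrix.mul_smul, ← Matrix.mul_assoc, ← Matrix.mul_assoc, h, Matrix.smul_mul, hη,
      smul_smul, inv_mul_cancel₀ hc, one_smul]
  have h2 := mul_eq_one_comm.mp h1
  have h3 : etaM n * Jᵀ * etaM n * J = c • (1 : Matrix _ _ ℝ) := by
    rw [← h2, Matrix.smul_mul, smul_smul, mul_inv_cancel₀ hc, one_smul]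
  calc Jᵀ * etaM n * J = etaM n * (etaM n * Jᵀ * etaM n * J) := by
        simp only [← Matrix.mul_assoc, hη, Matrix.one_mul]
    _ = c • etaM n := by rw [h3]; simp

/-- Pulling back wave solutions along `F` forces the rows of the Jacobian to be conformal. -/
lemma jacobian_mul_etaM_mul_transpose {n : ℕ} {F : (Fin (n + 1) → ℝ) → (Fin (n + 1) → ℝ)}
    (hF : ∀ k, ContDiff ℝ 2 fun z => F z k)
    (hwave : ∀ ψ : (Fin (n + 1) → ℝ) → ℝ, ContDiff ℝ 2 ψ →
      (∀ x, waveOp n ψ x = 0) → ∀ x, waveOp n (ψ ∘ F) x = 0) (x : Fin (n + 1) → ℝ)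
    (k l : Fin (n + 1)) :
    eta n (jacRow n F k x) (jacRow n F l x) =
      if k = l then -eta n (jacRow n F (Fin.last n) x) (jacRow n F (Fin.last n) x) * eps n k
      else 0 := by
  have hc : ∀ k : Fin (n + 1), ContDiff ℝ 2 fun z : Fin (n + 1) → ℝ => z k :=
    fun k => contDiff_apply ℝ ℝ k
  have h1 : ∀ k x, waveOp n (fun z => F z k) x = 0 := fun k =>
    hwave (fun z => z k) (hc k) (waveOp_coord k)
  have h2 : ∀ k l, waveOp n (fun z => F z k * F z l) x =
      2 * eta n (jacRow n F k x) (jacRow n F l x) := fun k l => by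
    rw [waveOp_mul (hF k) (hF l), h1, h1]
    simp [eta, jacRow]
  split_ifs with hkl
  · subst hkl
    by_cases hk : k = Fin.last n
    · subst hk; simp [eps]
    · have h3 := hwave (fun z => z k * z k + z (Fin.last n) * z (Fin.last n))
        (((hc _).mul (hc _)).add ((hc _).mul (hc _))) (fun y => by
          rw [waveOp_add ((hc _).mul (hc _)) ((hc _).mul (hc _)), waveOp_coord_mul_coord,
            waveOp_coord_mul_coord]
          simp [eps, hk]) x
      have h4 := waveOp_add ((hF k).mul (hF k)) ((hF (Fin.last n)).mul (hF (Fin.last n))) x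
      rw [h2, h2] at h4
      have h5 := h4.symm.trans h3
      simp only [eps, hk, if_false]
      linarith
  · have h3 := hwave (fun z => z k * z l) ((hc _).mul (hc _)) (fun y => by
      rw [waveOp_coord_mul_coord, if_neg hkl]) x
    have h4 := (h2 k l).symm.trans h3
    linarith

/-- In dimension at least three, a `C²` conformal map with wave-harmonic components and
invertible Jacobian has vanishing second derivatives. -/
lemma pd_pd_eq_zero_of_conformal {n : ℕ} (hn : 2 ≤ n)
    {F : (Fin (n + 1) → ℝ) → (Fin (n + 1) → ℝ)} (hF : ∀ k, ContDiff ℝ 2 fun z => F z k)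
    (hjac : ∀ x, (Matrix.of fun i j => pd n (fun z => F z i) j x).det ≠ 0)
    (hharm : ∀ k x, waveOp n (fun z => F z k) x = 0) {c : (Fin (n + 1) → ℝ) → ℝ}
    (hc : Differentiable ℝ c)
    (hconf : ∀ x i j, ∑ m, eps n m * (pd n (fun z => F z m) i x * pd n (fun z => F z m) j x) =
      (if i = j then eps n i else 0) * c x)
    (m i j : Fin (n + 1)) (x : Fin (n + 1) → ℝ) : pd n (pd n (fun z => F z m) i) j x = 0 := by
  have hd : ∀ m i, Differentiable ℝ (pd n (fun z => F z m) i) := fun m i =>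
    differentiable_pd (hF m) i
  set S : Fin (n + 1) → Fin (n + 1) → Fin (n + 1) → ℝ := fun i j k =>
    ∑ m, eps n m * (pd n (pd n (fun z => F z m) i) j x * pd n (fun z => F z m) k x) with hS
  have hsymm : ∀ i j k, S i j k = S j i k := fun i j k =>
    Finset.sum_congr rfl fun m _ => by rw [pd_comm (hF m)]
  have hderiv : ∀ i j k, S i k j + S j k i = (if i = j then eps n i else 0) * pd n c k x := by
    intro i j k
    have h := congrArg (fun φ => pd n φ k x) (funext fun x => hconf x i j)
    rw [pd_const_mul _ (hc x), pd_sum _ fun m _ =>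
      (((hd m i x).fun_mul (hd m j x)).const_mul (eps n m))] at h
    rw [← h, ← Finset.sum_add_distrib]
    refine Finset.sum_congr rfl fun m _ => ?_
    rw [pd_const_mul _ ((hd m i x).fun_mul (hd m j x)), pd_mul (hd m i x) (hd m j x)]
    ring
  have hchr : ∀ i j k, 2 * S i j k = (if j = k then eps n j else 0) * pd n c i x
      + (if i = k then eps n i else 0) * pd n c j x
      - (if i = j then eps n i else 0) * pd n c k x := by
    intro i j k
    rw [← hderiv j k i, ← hderiv i k j, ← hderiv i j k, hsymm j i k, hsymm k i j, hsymm k j i]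
    ring
  have htrace : ∀ k, ∑ i, eps n i * S i i k = 0 := by
    intro k
    simp only [hS, Finset.mul_sum]
    rw [Finset.sum_comm]
    refine Finset.sum_eq_zero fun m _ => ?_
    have h := hharm m x
    rw [waveOp] at h
    calc _ = eps n m * pd n (fun z => F z m) k x *
          ∑ i, eps n i * pd n (pd n (fun z => F z m) i) i x := by
          rw [Finset.mul_sum]
          exact Finset.sum_congr rfl fun i _ => by ring
      _ = 0 := by rw [h, mul_zero]
  have hgrad : ∀ k, pd n c k x = 0 := by
    intro k
    have h : ∑ i, eps n i * (2 * S i i k) = (1 - (n : ℝ)) * pd n c k x := by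
      calc _ = ∑ i, ((if i = k then 2 * pd n c k x else 0) - pd n c k x) := by
            refine Finset.sum_congr rfl fun i _ => ?_
            rw [hchr]
            by_cases hik : i = k
            · subst hik
              simp only [if_true]
              linear_combination pd n c i x * eps_mul_self n i
            · simp only [hik, if_false, if_true]
              linear_combination -pd n c k x * eps_mul_self n i
        _ = _ := by
            simp [Finset.sum_sub_distrib]
            ring
    have h' : ∑ i, eps n i * (2 * S i i k) = 2 * ∑ i, eps n i * S i i k := by
      rw [Finset.mul_sum]
      exact Finset.sum_congr rfl fun i _ => by ring
    rw [h', htrace, mul_zero] at h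
    have hn' : (2 : ℝ) ≤ n := by exact_mod_cast hn
    exact (mul_eq_zero.mp h.symm).resolve_left (by linarith)
  have hv : (fun m => eps n m * pd n (pd n (fun z => F z m) i) j x) = 0 := by
    refine Matrix.eq_zero_of_vecMul_eq_zero (hjac x) (funext fun k => ?_)
    have h := hchr i j k
    simp only [hgrad, mul_zero, add_zero, sub_zero, mul_eq_zero, two_ne_zero, false_or] at h
    rw [Pi.zero_apply, ← h]
    simp [Matrix.vecMul, dotProduct, hS, mul_assoc]
  exact (mul_eq_zero.mp (congrFun hv m)).resolve_left (eps_ne_zero n m)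

/-- A Lorentz matrix with nonnegative time-time entry is orthochronous. -/
lemma IsLorentz.one_le_last {n : ℕ} {A : Matrix (Fin (n + 1)) (Fin (n + 1)) ℝ}
    (hA : IsLorentz n A) (h0 : 0 ≤ A (Fin.last n) (Fin.last n)) :
    1 ≤ A (Fin.last n) (Fin.last n) := by
  have h := congrFun (congrFun hA (Fin.last n)) (Fin.last n)
  rw [Matrix.mul_apply] at h
  simp only [etaM, Matrix.mul_diagonal, Matrix.transpose_apply, Matrix.diagonal_apply_eq,
    Fin.sum_univ_castSucc, eps, (Fin.castSucc_lt_last _).ne, if_true, if_false, mul_one] at h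
  have hs : 0 ≤ ∑ i : Fin n, A i.castSucc (Fin.last n) * A i.castSucc (Fin.last n) :=
    Finset.sum_nonneg fun _ _ => mul_self_nonneg _
  nlinarith

/-- Regularity corollary: a `C²` diffeomorphism of `ℝ^{n+1}` (with `n ≥ 2`, everywhere
invertible Jacobian) with `∂y_{n+1}/∂x_{n+1} ≥ 0` which transforms `C²` solutions of the
wave equation exactly to solutions of the wave equation is automatically `C^∞`; indeed it is
affine: `F(x) = a • (A x) + b` with `a > 0` and `A` an orthochronous Lorentz matrix. -/
theorem c2_wave_preserving_is_smooth (n : ℕ) (hn : 2 ≤ n)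
    (F G : (Fin (n + 1) → ℝ) → (Fin (n + 1) → ℝ))
    (hF : ContDiff ℝ 2 F) (hG : ContDiff ℝ 2 G)
    (hGF : Function.LeftInverse G F) (hFG : Function.RightInverse G F)
    (hjac : ∀ x, (Matrix.of fun i j => pd n (fun z => F z i) j x).det ≠ 0)
    (hpos : ∀ x, 0 ≤ pd n (fun z => F z (Fin.last n)) (Fin.last n) x)
    (hwave : ∀ ψ : (Fin (n + 1) → ℝ) → ℝ, ContDiff ℝ 2 ψ →
      ((∀ x, waveOp n (ψ ∘ F) x = 0) ↔ (∀ x, waveOp n ψ x = 0))) :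
    ContDiff ℝ (⊤ : ℕ∞) F ∧
    ∃ (a : ℝ) (A : Matrix (Fin (n + 1)) (Fin (n + 1)) ℝ) (b : Fin (n + 1) → ℝ),
      0 < a ∧ IsLorentz n A ∧ 1 ≤ A (Fin.last n) (Fin.last n) ∧
      ∀ x, F x = a • A.mulVec x + b := by
  have hFk : ∀ k, ContDiff ℝ 2 fun z => F z k := fun k => contDiff_pi.mp hF k
  have hpull : ∀ ψ : (Fin (n + 1) → ℝ) → ℝ, ContDiff ℝ 2 ψ →
      (∀ x, waveOp n ψ x = 0) → ∀ x, waveOp n (ψ ∘ F) x = 0 := fun ψ hψ => (hwave ψ hψ).2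
  set J : (Fin (n + 1) → ℝ) → Matrix (Fin (n + 1)) (Fin (n + 1)) ℝ := fun x =>
    Matrix.of fun i j => pd n (fun z => F z i) j x with hJ
  set c : (Fin (n + 1) → ℝ) → ℝ := fun x =>
    -eta n (jacRow n F (Fin.last n) x) (jacRow n F (Fin.last n) x) with hc
  have hrow := jacobian_mul_etaM_mul_transpose hFk hpull
  have hrowM : ∀ x, J x * etaM n * (J x)ᵀ = c x • etaM n := fun x => by
    ext k l
    have h := hrow x k l
    rw [Matrix.mul_apply]
    simp only [etaM, Matrix.mul_diagonal, Matrix.transpose_apply, Matrix.smul_apply,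
      Matrix.diagonal_apply, smul_eq_mul, mul_ite, mul_zero]
    rw [← h]
    exact Finset.sum_congr rfl fun i _ => by simp only [hJ, jacRow, Matrix.of_apply]; ring
  have hc0 : ∀ x, c x ≠ 0 := fun x h0 => by
    have h := congrArg Matrix.det (hrowM x)
    rw [h0, zero_smul, Matrix.det_mul, Matrix.det_mul, Matrix.det_transpose,
      Matrix.det_zero, etaM, Matrix.det_diagonal] at h
    exact mul_ne_zero (mul_ne_zero (hjac x) (Finset.prod_ne_zero_iff.mpr fun i _ =>
      eps_ne_zero n i)) (hjac x) h
  have hcpos : ∀ x, 0 < c x := fun x => by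
    refine lt_of_le_of_ne (not_lt.mp fun hneg => ?_) (hc0 x).symm
    have e0 : (⟨0, by omega⟩ : Fin (n + 1)) ≠ Fin.last n := by simp [Fin.ext_iff]; omega
    have e1 : (⟨1, by omega⟩ : Fin (n + 1)) ≠ Fin.last n := by simp [Fin.ext_iff]; omega
    have r01 := hrow x ⟨0, by omega⟩ ⟨1, by omega⟩
    have r0 := hrow x ⟨0, by omega⟩ ⟨0, by omega⟩
    have r1 := hrow x ⟨1, by omega⟩ ⟨1, by omega⟩
    rw [if_neg (by simp)] at r01
    rw [if_pos rfl, eps, if_neg e0, mul_one] at r0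
    rw [if_pos rfl, eps, if_neg e1, mul_one] at r1
    exact not_both_timelike r01 (r0.trans_lt hneg) (r1.trans_lt hneg)
  have hcol : ∀ x, (J x)ᵀ * etaM n * J x = c x • etaM n := fun x =>
    transpose_mul_etaM_mul (hc0 x) (hrowM x)
  have hconf : ∀ x i j,
      ∑ m, eps n m * (pd n (fun z => F z m) i x * pd n (fun z => F z m) j x) =
      (if i = j then eps n i else 0) * c x := fun x i j => by
    have h := congrFun (congrFun (hcol x) i) j
    rw [Matrix.mul_apply] at h
    simp only [etaM, Matrix.mul_diagonal, Matrix.transpose_apply, Matrix.smul_apply,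
      Matrix.diagonal_apply, smul_eq_mul] at h
    rw [mul_comm, ← h]
    exact Finset.sum_congr rfl fun i _ => by simp only [hJ, Matrix.of_apply]; ring
  have hcd : Differentiable ℝ c := by
    have hd : ∀ i, Differentiable ℝ (pd n (fun z => F z (Fin.last n)) i) :=
      differentiable_pd (hFk _)
    simp only [hc, eta, jacRow]
    fun_prop
  have hzero := pd_pd_eq_zero_of_conformal hn hFk hjac
    (fun k => hpull (fun z => z k) (contDiff_apply ℝ ℝ k) (waveOp_coord k)) hcd hconf
  have haff : ∀ x, F x = (J 0).mulVec x + F 0 := fun x => funext fun m =>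
    eq_sum_pd_mul_add (hFk m) (hzero m) x
  have ha : 0 < √(c 0) := Real.sqrt_pos.mpr (hcpos 0)
  have hL : IsLorentz n ((√(c 0))⁻¹ • J 0) := by
    rw [IsLorentz, Matrix.transpose_smul, Matrix.smul_mul, Matrix.smul_mul, Matrix.mul_smul,
      hcol 0, smul_smul, smul_smul]
    conv_lhs => rw [← Real.mul_self_sqrt (hcpos 0).le]
    rw [Real.sqrt_mul_self ha.le]
    field_simp
    simp
  refine ⟨?_, √(c 0), (√(c 0))⁻¹ • J 0, F 0, ha, hL, ?_, fun x => ?_⟩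
  · rw [funext haff]
    exact ((J 0).mulVecLin.toContinuousLinearMap.contDiff).add contDiff_const
  · exact hL.one_le_last (mul_nonneg (inv_nonneg.mpr ha.le) (hpos 0))
  · rw [Matrix.smul_mulVec, smul_smul, mul_inv_cancel₀ ha.ne', one_smul]
    exact haff x
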